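/- (CBV one-step reverse simulation.) Let t be a CBV term, u' a λ!-term which is a →F,d!-normal form, and R' ∈ {dB, s!, d!}. If tᵛ (→F by rule R') ∘ (→F,d!)* u', then there exist a CBV term u with uᵛ = u' and a CBV rule R ∈ {dB, sV} with Rᵛ = R' such that t →ᵛF u by firing R under some CBV full context. -/

import Mathlib

namespace BangPaper

/-! ### Generic rewriting notions -/

/-- `a` is a normal form for the relation `r`. -/
def IsNF {α : Type*} (r : α → α → Prop) (a : α) : Prop := ∀ b, ¬ r a b

/-- Reflexive-transitive closure of the union of two relations,
counting the number of steps of each. -/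
inductive Counted2 {α : Type*} (r₁ r₂ : α → α → Prop) : ℕ → ℕ → α → α → Prop
  | refl (t : α) : Counted2 r₁ r₂ 0 0 t t
  | step₁ {t u v : α} {m n : ℕ} :
      r₁ t u → Counted2 r₁ r₂ m n u v → Counted2 r₁ r₂ (m + 1) n t v
  | step₂ {t u v : α} {m n : ℕ} :
      r₂ t u → Counted2 r₁ r₂ m n u v → Counted2 r₁ r₂ m (n + 1) t v

/-- Reflexive-transitive closure of the union of three relations,
counting the number of steps of each. -/
inductive Counted3 {α : Type*} (r₁ r₂ r₃ : α → α → Prop) : ℕ → ℕ → ℕ → α → α → Prop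
  | refl (t : α) : Counted3 r₁ r₂ r₃ 0 0 0 t t
  | step₁ {t u v : α} {m n k : ℕ} :
      r₁ t u → Counted3 r₁ r₂ r₃ m n k u v → Counted3 r₁ r₂ r₃ (m + 1) n k t v
  | step₂ {t u v : α} {m n k : ℕ} :
      r₂ t u → Counted3 r₁ r₂ r₃ m n k u v → Counted3 r₁ r₂ r₃ m (n + 1) k t v
  | step₃ {t u v : α} {m n k : ℕ} :
      r₃ t u → Counted3 r₁ r₂ r₃ m n k u v → Counted3 r₁ r₂ r₃ m n (k + 1) t v

/-! ### Terms of the distant Bang calculus λ! (de Bruijn representation) -/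

/-- Terms of λ!: variables, application, abstraction, bang, dereliction and
explicit substitution (`sub t u` is `t[x←u]`, the binder being in `t`). -/
inductive T : Type
  | var : ℕ → T
  | app : T → T → T
  | lam : T → T
  | bang : T → T
  | der : T → T
  | sub : T → T → T

namespace T

/-- Lift (shift by one) the free de Bruijn variables `≥ k`. -/
def lift (k : ℕ) : T → T
  | var n => if n < k then var n else var (n + 1)
  | app a b => app (lift k a) (lift k b)
  | lam a => lam (lift (k + 1) a)
  | bang a => bang (lift k a)
  | der a => der (lift k a)
  | sub a b => sub (lift (k + 1) a) (lift k b)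

/-- Lift all free variables by `m` (crossing `m` binders). -/
def liftN (m : ℕ) (t : T) : T := (lift 0)^[m] t

/-- Lift all free variables except the first one by `m`
(used to push a term with one distinguished bound variable under `m` extra binders). -/
def liftUnder (m : ℕ) (t : T) : T := (lift 1)^[m] t

/-- Capture-avoiding substitution `t{k := u}` of `u` for de Bruijn variable `k`. -/
def subst : T → ℕ → T → T
  | var n, k, u => if n < k then var n else if n = k then liftN k u else var (n - 1)
  | app a b, k, u => app (subst a k u) (subst b k u)
  | lam a, k, u => lam (subst a (k + 1) u)
  | bang a, k, u => bang (subst a k u)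
  | der a, k, u => der (subst a k u)
  | sub a b, k, u => sub (subst a (k + 1) u) (subst b k u)

/-- The number of constructors (full size) of a term: it counts all
applications, abstractions, explicit substitutions, `!` and `der` occurrences. -/
def size : T → ℕ
  | var _ => 0
  | app a b => 1 + size a + size b
  | lam a => 1 + size a
  | bang a => 1 + size a
  | der a => 1 + size a
  | sub a b => 1 + size a + size b

end T

/-- Plugging a term into a list context `⟨·⟩[x₁←t₁]…[xₙ←tₙ]`
(represented as the list `[t₁, …, tₙ]`). -/
def fillL : T → List T → T
  | s, [] => s
  | s, t :: L => fillL (T.sub s t) L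

/-! ### Rewrite rules of λ! -/

/-- The names of the three rewrite rules of λ!: `dB`, `s!` and `d!`. -/
inductive Rule : Type
  | dB : Rule
  | sBang : Rule
  | dBang : Rule

/-- Root steps of the three rewrite rules of λ! (at a distance, capture-free):
`(dB)  L⟨λx.t⟩ u ↦ L⟨t[x←u]⟩`, `(s!)  t[x←L⟨!u⟩] ↦ L⟨t{x:=u}⟩`,
`(d!)  der(L⟨!t⟩) ↦ L⟨t⟩`. -/
inductive Root : Rule → T → T → Prop
  | dB (t u : T) (L : List T) :
      Root Rule.dB (T.app (fillL (T.lam t) L) u)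
        (fillL (T.sub t (T.liftN L.length u)) L)
  | sBang (t u : T) (L : List T) :
      Root Rule.sBang (T.sub t (fillL (T.bang u) L))
        (fillL (T.subst (T.liftUnder L.length t) 0 u) L)
  | dBang (t : T) (L : List T) :
      Root Rule.dBang (T.der (fillL (T.bang t) L)) (fillL t L)

/-! ### Contexts of λ! -/

/-- (Full) contexts of λ!: terms with exactly one hole, the hole may occur anywhere. -/
inductive Ctx : Type
  | hole : Ctx
  | appL : Ctx → T → Ctx
  | appR : T → Ctx → Ctx
  | lam : Ctx → Ctx
  | bang : Ctx → Ctx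
  | der : Ctx → Ctx
  | subL : Ctx → T → Ctx
  | subR : T → Ctx → Ctx

namespace Ctx

/-- Plugging a term in a context (possibly capturing its free variables). -/
def fill : Ctx → T → T
  | hole, s => s
  | appL C t, s => T.app (fill C s) t
  | appR t C, s => T.app t (fill C s)
  | lam C, s => T.lam (fill C s)
  | bang C, s => T.bang (fill C s)
  | der C, s => T.der (fill C s)
  | subL C t, s => T.sub (fill C s) t
  | subR t C, s => T.sub t (fill C s)

/-- Surface contexts: the hole does not occur under a `!`. -/
def Surface : Ctx → Prop
  | hole => True
  | appL C _ => Surface C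
  | appR _ C => Surface C
  | lam C => Surface C
  | bang _ => False
  | der C => Surface C
  | subL C _ => Surface C
  | subR _ C => Surface C

/-- Internal contexts: the full contexts that are not surface (the hole occurs under a `!`). -/
def Internal (C : Ctx) : Prop := ¬ Surface C

end Ctx

/-! ### Reductions of λ! -/

/-- `StepAt R C t u`: `t` rewrites to `u` by firing a redex of rule `R` under context `C`. -/
def StepAt (R : Rule) (C : Ctx) (t u : T) : Prop :=
  ∃ a b, Root R a b ∧ t = C.fill a ∧ u = C.fill b

/-- One step of rule `R` under some full context (`→F,R`). -/
def FStepR (R : Rule) (t u : T) : Prop := ∃ C : Ctx, StepAt R C t u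

/-- One step of rule `R` under some surface context (`→S,R`). -/
def SStepR (R : Rule) (t u : T) : Prop := ∃ C : Ctx, C.Surface ∧ StepAt R C t u

/-- One step of rule `R` under some internal context (`→I,R`). -/
def IStepR (R : Rule) (t u : T) : Prop := ∃ C : Ctx, C.Internal ∧ StepAt R C t u

/-- Full reduction `→F` of λ!. -/
def FStep (t u : T) : Prop := ∃ R, FStepR R t u

/-- Surface reduction `→S` of λ!. -/
def SStep (t u : T) : Prop := ∃ R, SStepR R t u

/-- Internal reduction `→I` of λ!. -/
def IStep (t u : T) : Prop := ∃ R, IStepR R t u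

/-- Diligent administrative surface reduction `→Sai`: `d!`-surface steps, together with
`dB`- and `s!`-surface steps whose source is a `→S,d!`-normal form. -/
def SaiStep (t u : T) : Prop :=
  SStepR Rule.dBang t u ∨
    ((SStepR Rule.dB t u ∨ SStepR Rule.sBang t u) ∧ IsNF (SStepR Rule.dBang) t)

/-- Diligent administrative full reduction `→Fai`: `d!`-full steps, together with
`dB`- and `s!`-full steps whose source is a `→F,d!`-normal form. -/
def FaiStep (t u : T) : Prop :=
  FStepR Rule.dBang t u ∨
    ((FStepR Rule.dB t u ∨ FStepR Rule.sBang t u) ∧ IsNF (FStepR Rule.dBang) t)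

/-! ### Terms of the CBN / CBV calculi (shared syntax, de Bruijn) -/

/-- Terms of the CBN/CBV calculi: variables, application, abstraction and
explicit substitution (no `!`, no `der`). -/
inductive LT : Type
  | var : ℕ → LT
  | app : LT → LT → LT
  | lam : LT → LT
  | sub : LT → LT → LT

namespace LT

/-- Lift (shift by one) the free de Bruijn variables `≥ k`. -/
def lift (k : ℕ) : LT → LT
  | var n => if n < k then var n else var (n + 1)
  | app a b => app (lift k a) (lift k b)
  | lam a => lam (lift (k + 1) a)
  | sub a b => sub (lift (k + 1) a) (lift k b)

/-- Lift all free variables by `m`. -/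
def liftN (m : ℕ) (t : LT) : LT := (lift 0)^[m] t

/-- Lift all free variables except the first one by `m`. -/
def liftUnder (m : ℕ) (t : LT) : LT := (lift 1)^[m] t

/-- Capture-avoiding substitution `t{k := u}`. -/
def subst : LT → ℕ → LT → LT
  | var n, k, u => if n < k then var n else if n = k then liftN k u else var (n - 1)
  | app a b, k, u => app (subst a k u) (subst b k u)
  | lam a, k, u => lam (subst a (k + 1) u)
  | sub a b, k, u => sub (subst a (k + 1) u) (subst b k u)

/-- Values: variables and abstractions. -/
def IsValue : LT → Prop
  | var _ => True
  | lam _ => True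
  | _ => False

end LT

/-- Plugging a CBN/CBV term into a list context. -/
def fillLN : LT → List LT → LT
  | s, [] => s
  | s, t :: L => fillLN (LT.sub s t) L

/-- The names of the CBN rewrite rules: `dB` and `s`. -/
inductive NRule : Type
  | dB : NRule
  | s : NRule

/-- Root steps of the CBN rules:
`(dB) L⟨λx.t⟩ u ↦ L⟨t[x←u]⟩` and `(s) t[x←u] ↦ t{x:=u}`. -/
inductive NRoot : NRule → LT → LT → Prop
  | dB (t u : LT) (L : List LT) :
      NRoot NRule.dB (LT.app (fillLN (LT.lam t) L) u)
        (fillLN (LT.sub t (LT.liftN L.length u)) L)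
  | s (t u : LT) : NRoot NRule.s (LT.sub t u) (LT.subst t 0 u)

/-- The names of the CBV rewrite rules: `dB` and `sV`. -/
inductive VRule : Type
  | dB : VRule
  | sV : VRule

/-- Root steps of the CBV rules:
`(dB) L⟨λx.t⟩ u ↦ L⟨t[x←u]⟩` and `(sV) t[x←L⟨v⟩] ↦ L⟨t{x:=v}⟩` for `v` a value. -/
inductive VRoot : VRule → LT → LT → Prop
  | dB (t u : LT) (L : List LT) :
      VRoot VRule.dB (LT.app (fillLN (LT.lam t) L) u)
        (fillLN (LT.sub t (LT.liftN L.length u)) L)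
  | sV (t v : LT) (L : List LT) : v.IsValue →
      VRoot VRule.sV (LT.sub t (fillLN v L))
        (fillLN (LT.subst (LT.liftUnder L.length t) 0 v) L)

/-- (Full) contexts of the CBN/CBV calculi. -/
inductive LCtx : Type
  | hole : LCtx
  | appL : LCtx → LT → LCtx
  | appR : LT → LCtx → LCtx
  | lam : LCtx → LCtx
  | subL : LCtx → LT → LCtx
  | subR : LT → LCtx → LCtx

namespace LCtx

/-- Plugging a term in a CBN/CBV context. -/
def fill : LCtx → LT → LT
  | hole, s => s
  | appL C t, s => LT.app (fill C s) t
  | appR t C, s => LT.app t (fill C s)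
  | lam C, s => LT.lam (fill C s)
  | subL C t, s => LT.sub (fill C s) t
  | subR t C, s => LT.sub t (fill C s)

/-- CBN surface contexts: the hole never occurs in the argument of an application
or of an explicit substitution. -/
def NSurface : LCtx → Prop
  | hole => True
  | appL C _ => NSurface C
  | appR _ _ => False
  | lam C => NSurface C
  | subL C _ => NSurface C
  | subR _ _ => False

/-- CBV surface contexts: the hole never occurs under an abstraction. -/
def VSurface : LCtx → Prop
  | hole => True
  | appL C _ => VSurface C
  | appR _ C => VSurface C
  | lam _ => False
  | subL C _ => VSurface C
  | subR _ C => VSurface C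

end LCtx

/-- `NStepAt R C t u`: the CBN step firing rule `R` under context `C`. -/
def NStepAt (R : NRule) (C : LCtx) (t u : LT) : Prop :=
  ∃ a b, NRoot R a b ∧ t = C.fill a ∧ u = C.fill b

/-- `VStepAt R C t u`: the CBV step firing rule `R` under context `C`. -/
def VStepAt (R : VRule) (C : LCtx) (t u : LT) : Prop :=
  ∃ a b, VRoot R a b ∧ t = C.fill a ∧ u = C.fill b

/-- One CBN step of rule `R` under some full context. -/
def NFStepR (R : NRule) (t u : LT) : Prop := ∃ C : LCtx, NStepAt R C t u

/-- One CBN step of rule `R` under some surface context. -/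
def NSStepR (R : NRule) (t u : LT) : Prop := ∃ C : LCtx, C.NSurface ∧ NStepAt R C t u

/-- One CBN step of rule `R` under some internal context. -/
def NIStepR (R : NRule) (t u : LT) : Prop := ∃ C : LCtx, ¬ C.NSurface ∧ NStepAt R C t u

/-- CBN full reduction `→ⁿF`. -/
def NFStep (t u : LT) : Prop := ∃ R, NFStepR R t u

/-- CBN surface reduction `→ⁿS`. -/
def NSStep (t u : LT) : Prop := ∃ R, NSStepR R t u

/-- CBN internal reduction `→ⁿI`. -/
def NIStep (t u : LT) : Prop := ∃ R, NIStepR R t u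

/-- One CBV step of rule `R` under some full context. -/
def VFStepR (R : VRule) (t u : LT) : Prop := ∃ C : LCtx, VStepAt R C t u

/-- One CBV step of rule `R` under some surface context. -/
def VSStepR (R : VRule) (t u : LT) : Prop := ∃ C : LCtx, C.VSurface ∧ VStepAt R C t u

/-- One CBV step of rule `R` under some internal context. -/
def VIStepR (R : VRule) (t u : LT) : Prop := ∃ C : LCtx, ¬ C.VSurface ∧ VStepAt R C t u

/-- CBV full reduction `→ᵛF`. -/
def VFStep (t u : LT) : Prop := ∃ R, VFStepR R t u

/-- CBV surface reduction `→ᵛS`. -/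
def VSStep (t u : LT) : Prop := ∃ R, VSStepR R t u

/-- CBV internal reduction `→ᵛI`. -/
def VIStep (t u : LT) : Prop := ∃ R, VIStepR R t u

/-! ### The CBN embedding into λ! -/

/-- The CBN embedding `(·)ⁿ : xⁿ = x, (λx.t)ⁿ = λx.tⁿ, (t u)ⁿ = tⁿ !(uⁿ),
(t[x←u])ⁿ = tⁿ[x←!(uⁿ)]`. -/
def embN : LT → T
  | LT.var n => T.var n
  | LT.app t u => T.app (embN t) (T.bang (embN u))
  | LT.lam t => T.lam (embN t)
  | LT.sub t u => T.sub (embN t) (T.bang (embN u))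

/-- The CBN embedding extended to contexts, with `⟨·⟩ⁿ = ⟨·⟩`. -/
def embNC : LCtx → Ctx
  | LCtx.hole => Ctx.hole
  | LCtx.appL C t => Ctx.appL (embNC C) (T.bang (embN t))
  | LCtx.appR t C => Ctx.appR (embN t) (Ctx.bang (embNC C))
  | LCtx.lam C => Ctx.lam (embNC C)
  | LCtx.subL C t => Ctx.subL (embNC C) (T.bang (embN t))
  | LCtx.subR t C => Ctx.subR (embN t) (Ctx.bang (embNC C))

/-- The CBN embedding on rule names: `dBⁿ = dB`, `sⁿ = s!`. -/
def embNRule : NRule → Rule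
  | NRule.dB => Rule.dB
  | NRule.s => Rule.sBang

/-! ### The CBV embedding into λ! -/

/-- If `t = L⟨!s⟩` for a list context `L`, return `some L⟨s⟩`, otherwise `none`. -/
def strip? : T → Option T
  | T.bang s => some s
  | T.sub a b => (strip? a).map (fun a' => T.sub a' b)
  | _ => none

/-- The (new) CBV embedding `(·)ᵛ : xᵛ = !x, (λx.t)ᵛ = !λx.!(tᵛ),
(t u)ᵛ = der(L⟨s⟩ uᵛ)` if `tᵛ = L⟨!s⟩` and `der(der(tᵛ) uᵛ)` otherwise,
`(t[x←u])ᵛ = tᵛ[x←uᵛ]`. -/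
def embV : LT → T
  | LT.var n => T.bang (T.var n)
  | LT.lam t => T.bang (T.lam (T.bang (embV t)))
  | LT.app t u =>
      match strip? (embV t) with
      | some s => T.der (T.app s (embV u))
      | none => T.der (T.app (T.der (embV t)) (embV u))
  | LT.sub t u => T.sub (embV t) (embV u)

/-- The CBV embedding on rule names: `dBᵛ = dB`, `sVᵛ = s!`. -/
def embVRule : VRule → Rule
  | VRule.dB => Rule.dB
  | VRule.sV => Rule.sBang

/-! ### Normalization with respect to `d!` -/

/-- The `d!`-reduct of `der a` at the root if there is one, and `der a` itself otherwise. -/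
def derStrip (a : T) : T := (strip? a).getD (T.der a)

theorem embV_app (t u : LT) :
    embV (LT.app t u) = T.der (T.app (derStrip (embV t)) (embV u)) := by
  cases h : strip? (embV t) <;> simp [embV, derStrip, h]

/-- The `→F,d!`-normal form of a term. -/
def dNF : T → T
  | T.var n => T.var n
  | T.app a b => T.app (dNF a) (dNF b)
  | T.lam a => T.lam (dNF a)
  | T.bang a => T.bang (dNF a)
  | T.der a => derStrip (dNF a)
  | T.sub a b => T.sub (dNF a) (dNF b)

theorem fillL_append (s : T) (L M : List T) : fillL s (L ++ M) = fillL (fillL s L) M := by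
  induction L generalizing s with
  | nil => rfl
  | cons t L ih => exact ih _

theorem fillLN_append (s : LT) (L M : List LT) :
    fillLN s (L ++ M) = fillLN (fillLN s L) M := by
  induction L generalizing s with
  | nil => rfl
  | cons t L ih => exact ih _

theorem dNF_fillL (s : T) (L : List T) : dNF (fillL s L) = fillL (dNF s) (L.map dNF) := by
  induction L generalizing s with
  | nil => rfl
  | cons t L ih => exact ih _

theorem embV_fillLN (s : LT) (L : List LT) :
    embV (fillLN s L) = fillL (embV s) (L.map embV) := by
  induction L generalizing s with
  | nil => rfl
  | cons t L ih => exact ih _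

theorem strip?_fillL {a s : T} (h : strip? a = some s) (L : List T) :
    strip? (fillL a L) = some (fillL s L) := by
  induction L generalizing a s with
  | nil => exact h
  | cons t L ih => exact ih (by simp [strip?, h])

theorem exists_fillL_of_strip? {a s : T} (h : strip? a = some s) :
    ∃ b L, a = fillL (T.bang b) L ∧ s = fillL b L := by
  induction a generalizing s with
  | bang a => exact ⟨a, [], rfl, by simpa [strip?, fillL] using h.symm⟩
  | sub a b iha ihb =>
    simp only [strip?, Option.map_eq_some_iff] at h
    obtain ⟨a', ha, rfl⟩ := h
    obtain ⟨c, L, rfl, rfl⟩ := iha ha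
    exact ⟨c, L ++ [b], by rw [fillL_append]; rfl, by rw [fillL_append]; rfl⟩
  | _ => simp [strip?] at h

theorem strip?_dNF {a s : T} (h : strip? a = some s) : strip? (dNF a) = some (dNF s) := by
  obtain ⟨b, L, rfl, rfl⟩ := exists_fillL_of_strip? h
  rw [dNF_fillL, dNF_fillL]
  exact strip?_fillL rfl _

theorem dNF_derStrip (a : T) : dNF (derStrip a) = derStrip (dNF a) := by
  cases h : strip? a with
  | none => simp [derStrip, h, dNF]
  | some s => simp [derStrip, h, strip?_dNF h]

theorem dNF_fill_congr (C : Ctx) {a b : T} (h : dNF a = dNF b) :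
    dNF (C.fill a) = dNF (C.fill b) := by
  induction C <;> simp_all [Ctx.fill, dNF]

theorem dNF_eq_of_step {a b : T} (h : FStepR Rule.dBang a b) : dNF a = dNF b := by
  obtain ⟨C, a, b, hr, rfl, rfl⟩ := h
  apply dNF_fill_congr
  cases hr with
  | dBang t L => simp [dNF, dNF_fillL, derStrip, strip?_fillL (a := T.bang (dNF t)) rfl]

theorem dNF_eq_of_steps {a b : T} (h : Relation.ReflTransGen (FStepR Rule.dBang) a b) :
    dNF a = dNF b := by
  induction h with
  | refl => rfl
  | tail _ hs ih => exact ih.trans (dNF_eq_of_step hs)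

/-! ### Full steps of λ! and contexts -/

namespace FStepR

variable {R : Rule} {a b c : T}

theorem root (h : Root R a b) : FStepR R a b := ⟨Ctx.hole, a, b, h, rfl, rfl⟩

theorem appL (h : FStepR R a b) : FStepR R (T.app a c) (T.app b c) := by
  obtain ⟨C, x, y, hr, rfl, rfl⟩ := h
  exact ⟨Ctx.appL C c, x, y, hr, rfl, rfl⟩

theorem appR (h : FStepR R a b) : FStepR R (T.app c a) (T.app c b) := by
  obtain ⟨C, x, y, hr, rfl, rfl⟩ := h
  exact ⟨Ctx.appR c C, x, y, hr, rfl, rfl⟩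

theorem lam (h : FStepR R a b) : FStepR R (T.lam a) (T.lam b) := by
  obtain ⟨C, x, y, hr, rfl, rfl⟩ := h
  exact ⟨Ctx.lam C, x, y, hr, rfl, rfl⟩

theorem bang (h : FStepR R a b) : FStepR R (T.bang a) (T.bang b) := by
  obtain ⟨C, x, y, hr, rfl, rfl⟩ := h
  exact ⟨Ctx.bang C, x, y, hr, rfl, rfl⟩

theorem der (h : FStepR R a b) : FStepR R (T.der a) (T.der b) := by
  obtain ⟨C, x, y, hr, rfl, rfl⟩ := h
  exact ⟨Ctx.der C, x, y, hr, rfl, rfl⟩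

theorem subL (h : FStepR R a b) : FStepR R (T.sub a c) (T.sub b c) := by
  obtain ⟨C, x, y, hr, rfl, rfl⟩ := h
  exact ⟨Ctx.subL C c, x, y, hr, rfl, rfl⟩

theorem subR (h : FStepR R a b) : FStepR R (T.sub c a) (T.sub c b) := by
  obtain ⟨C, x, y, hr, rfl, rfl⟩ := h
  exact ⟨Ctx.subR c C, x, y, hr, rfl, rfl⟩

theorem var_inv {n : ℕ} (h : FStepR R (T.var n) b) : False := by
  obtain ⟨C, x, y, hr, e, rfl⟩ := h
  cases C with
  | hole => simp only [Ctx.fill] at e; subst e; cases hr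
  | _ => cases e

theorem lam_inv (h : FStepR R (T.lam a) b) : ∃ a', FStepR R a a' ∧ b = T.lam a' := by
  obtain ⟨C, x, y, hr, e, rfl⟩ := h
  cases C with
  | hole => simp only [Ctx.fill] at e; subst e; cases hr
  | lam C => cases e; exact ⟨_, ⟨C, x, y, hr, rfl, rfl⟩, rfl⟩
  | _ => cases e

theorem bang_inv (h : FStepR R (T.bang a) b) : ∃ a', FStepR R a a' ∧ b = T.bang a' := by
  obtain ⟨C, x, y, hr, e, rfl⟩ := h
  cases C with
  | hole => simp only [Ctx.fill] at e; subst e; cases hr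
  | bang C => cases e; exact ⟨_, ⟨C, x, y, hr, rfl, rfl⟩, rfl⟩
  | _ => cases e

theorem der_inv (h : FStepR R (T.der a) b) :
    Root R (T.der a) b ∨ ∃ a', FStepR R a a' ∧ b = T.der a' := by
  obtain ⟨C, x, y, hr, e, rfl⟩ := h
  cases C with
  | hole => simp only [Ctx.fill] at e; subst e; exact .inl hr
  | der C => cases e; exact .inr ⟨_, ⟨C, x, y, hr, rfl, rfl⟩, rfl⟩
  | _ => cases e

theorem app_inv (h : FStepR R (T.app a c) b) :
    Root R (T.app a c) b ∨ (∃ a', FStepR R a a' ∧ b = T.app a' c) ∨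
      ∃ c', FStepR R c c' ∧ b = T.app a c' := by
  obtain ⟨C, x, y, hr, e, rfl⟩ := h
  cases C with
  | hole => simp only [Ctx.fill] at e; subst e; exact .inl hr
  | appL C => cases e; exact .inr (.inl ⟨_, ⟨C, x, y, hr, rfl, rfl⟩, rfl⟩)
  | appR _ C => cases e; exact .inr (.inr ⟨_, ⟨C, x, y, hr, rfl, rfl⟩, rfl⟩)
  | _ => cases e

theorem sub_inv (h : FStepR R (T.sub a c) b) :
    Root R (T.sub a c) b ∨ (∃ a', FStepR R a a' ∧ b = T.sub a' c) ∨
      ∃ c', FStepR R c c' ∧ b = T.sub a c' := by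
  obtain ⟨C, x, y, hr, e, rfl⟩ := h
  cases C with
  | hole => simp only [Ctx.fill] at e; subst e; exact .inl hr
  | subL C => cases e; exact .inr (.inl ⟨_, ⟨C, x, y, hr, rfl, rfl⟩, rfl⟩)
  | subR _ C => cases e; exact .inr (.inr ⟨_, ⟨C, x, y, hr, rfl, rfl⟩, rfl⟩)
  | _ => cases e

end FStepR

theorem dNF_eq_self {a : T} (h : IsNF (FStepR Rule.dBang) a) : dNF a = a := by
  induction a with
  | var n => rfl
  | app a b iha ihb =>
    rw [dNF, iha fun _ hs => h _ hs.appL, ihb fun _ hs => h _ hs.appR]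
  | lam a ih => rw [dNF, ih fun _ hs => h _ hs.lam]
  | bang a ih => rw [dNF, ih fun _ hs => h _ hs.bang]
  | der a ih =>
    rw [dNF, ih fun _ hs => h _ hs.der]
    cases hs : strip? a with
    | none => simp [derStrip, hs]
    | some s =>
      obtain ⟨b, L, rfl, rfl⟩ := exists_fillL_of_strip? hs
      exact absurd (FStepR.root (Root.dBang b L)) (h _)
  | sub a b iha ihb =>
    rw [dNF, iha fun _ hs => h _ hs.subL, ihb fun _ hs => h _ hs.subR]

namespace VFStepR

variable {R : VRule} {a b c : LT}

theorem root (h : VRoot R a b) : VFStepR R a b := ⟨LCtx.hole, a, b, h, rfl, rfl⟩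

theorem appL (h : VFStepR R a b) : VFStepR R (LT.app a c) (LT.app b c) := by
  obtain ⟨C, x, y, hr, rfl, rfl⟩ := h
  exact ⟨LCtx.appL C c, x, y, hr, rfl, rfl⟩

theorem appR (h : VFStepR R a b) : VFStepR R (LT.app c a) (LT.app c b) := by
  obtain ⟨C, x, y, hr, rfl, rfl⟩ := h
  exact ⟨LCtx.appR c C, x, y, hr, rfl, rfl⟩

theorem lam (h : VFStepR R a b) : VFStepR R (LT.lam a) (LT.lam b) := by
  obtain ⟨C, x, y, hr, rfl, rfl⟩ := h
  exact ⟨LCtx.lam C, x, y, hr, rfl, rfl⟩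

theorem subL (h : VFStepR R a b) : VFStepR R (LT.sub a c) (LT.sub b c) := by
  obtain ⟨C, x, y, hr, rfl, rfl⟩ := h
  exact ⟨LCtx.subL C c, x, y, hr, rfl, rfl⟩

theorem subR (h : VFStepR R a b) : VFStepR R (LT.sub c a) (LT.sub c b) := by
  obtain ⟨C, x, y, hr, rfl, rfl⟩ := h
  exact ⟨LCtx.subR c C, x, y, hr, rfl, rfl⟩

end VFStepR

/-! ### Stripping a bang commutes with lifting, substitution and reduction -/

theorem strip?_lift {a s : T} (h : strip? a = some s) (k : ℕ) :
    strip? (T.lift k a) = some (T.lift k s) := by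
  induction a generalizing s k with
  | bang a => simp_all [strip?, T.lift]
  | sub a b iha ihb =>
    simp only [strip?, Option.map_eq_some_iff] at h
    obtain ⟨a', ha, rfl⟩ := h
    simp [strip?, T.lift, iha ha]
  | _ => simp [strip?] at h

theorem strip?_liftUnder {a s : T} (h : strip? a = some s) (m : ℕ) :
    strip? (T.liftUnder m a) = some (T.liftUnder m s) := by
  induction m generalizing a s with
  | zero => exact h
  | succ m ih => exact ih (strip?_lift h 1)

theorem strip?_subst {a s : T} (h : strip? a = some s) (k : ℕ) (u : T) :
    strip? (T.subst a k u) = some (T.subst s k u) := by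
  induction a generalizing s k with
  | bang a => simp_all [strip?, T.subst]
  | sub a b iha ihb =>
    simp only [strip?, Option.map_eq_some_iff] at h
    obtain ⟨a', ha, rfl⟩ := h
    simp [strip?, T.subst, iha ha]
  | _ => simp [strip?] at h

theorem exists_step_of_strip? {R : Rule} {a s s' : T} (h : strip? a = some s)
    (hs : FStepR R s s') : ∃ a', FStepR R a a' ∧ strip? a' = some s' := by
  induction a generalizing s s' with
  | bang a =>
    simp only [strip?, Option.some.injEq] at h
    subst h
    exact ⟨_, hs.bang, rfl⟩
  | sub a b iha ihb =>
    simp only [strip?, Option.map_eq_some_iff] at h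
    obtain ⟨s, ha, rfl⟩ := h
    rcases hs.sub_inv with hr | ⟨c, hc, rfl⟩ | ⟨c, hc, rfl⟩
    · cases hr with
      | sBang _ u L =>
        exact ⟨_, FStepR.root (Root.sBang a u L),
          strip?_fillL (strip?_subst (strip?_liftUnder ha _) _ _) L⟩
    · obtain ⟨a', hst, ha'⟩ := iha ha hc
      exact ⟨_, hst.subL, by simp [strip?, ha']⟩
    · exact ⟨_, hc.subR, by simp [strip?, ha]⟩
  | _ => simp [strip?] at h

theorem exists_step_of_derStrip {R : Rule} {a s : T} (h : FStepR R (derStrip a) s) :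
    ∃ a', FStepR R a a' ∧ dNF s = derStrip (dNF a') := by
  cases ha : strip? a with
  | none =>
    simp only [derStrip, ha, Option.getD_none] at h
    rcases h.der_inv with hr | ⟨a', h', rfl⟩
    · cases hr with
      | dBang t L => simp [strip?_fillL (a := T.bang t) rfl] at ha
    · exact ⟨a', h', rfl⟩
  | some b =>
    simp only [derStrip, ha, Option.getD_some] at h
    obtain ⟨a', h', ha'⟩ := exists_step_of_strip? ha h
    exact ⟨a', h', by simp [derStrip, strip?_dNF ha']⟩

/-! ### The CBV embedding commutes with lifting and substitution -/

theorem strip?_lift_embV (t : LT) (k : ℕ) :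
    strip? (T.lift k (embV t)) = (strip? (embV t)).map (T.lift k) := by
  induction t generalizing k with
  | var n => simp [embV, T.lift, strip?]
  | lam t => simp [embV, T.lift, strip?]
  | app t u => simp [embV_app, T.lift, strip?]
  | sub t u iht ihu =>
    simp only [embV, T.lift, strip?, iht, Option.map_map]
    rfl

theorem strip?_subst_embV (t : LT) (k : ℕ) (v : T) :
    strip? (T.subst (embV t) k v) = (strip? (embV t)).map (T.subst · k v) := by
  induction t generalizing k with
  | var n => simp [embV, T.subst, strip?]
  | lam t => simp [embV, T.subst, strip?]
  | app t u => simp [embV_app, T.subst, strip?]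
  | sub t u iht ihu =>
    simp only [embV, T.subst, strip?, iht, Option.map_map]
    rfl

theorem lift_derStrip_embV (t : LT) (k : ℕ) :
    T.lift k (derStrip (embV t)) = derStrip (T.lift k (embV t)) := by
  cases ht : strip? (embV t) <;> simp [derStrip, strip?_lift_embV, ht, T.lift]

theorem subst_derStrip_embV (t : LT) (k : ℕ) (v : T) :
    T.subst (derStrip (embV t)) k v = derStrip (T.subst (embV t) k v) := by
  cases ht : strip? (embV t) <;> simp [derStrip, strip?_subst_embV, ht, T.subst]

theorem embV_lift (t : LT) (k : ℕ) : embV (LT.lift k t) = T.lift k (embV t) := by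
  induction t generalizing k with
  | var n => simp only [LT.lift, embV, T.lift]; split <;> rfl
  | lam t ih => simp [LT.lift, embV, T.lift, ih]
  | app t u iht ihu => simp [LT.lift, embV_app, T.lift, iht, ihu, lift_derStrip_embV]
  | sub t u iht ihu => simp [LT.lift, embV, T.lift, iht, ihu]

theorem embV_liftN (t : LT) (m : ℕ) : embV (LT.liftN m t) = T.liftN m (embV t) := by
  induction m generalizing t with
  | zero => rfl
  | succ m ih => exact (ih _).trans (congrArg (T.liftN m) (embV_lift t 0))

theorem embV_liftUnder (t : LT) (m : ℕ) :
    embV (LT.liftUnder m t) = T.liftUnder m (embV t) := by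
  induction m generalizing t with
  | zero => rfl
  | succ m ih => exact (ih _).trans (congrArg (T.liftUnder m) (embV_lift t 1))

theorem T.liftN_bang (a : T) (m : ℕ) : T.liftN m (T.bang a) = T.bang (T.liftN m a) := by
  induction m generalizing a with
  | zero => rfl
  | succ m ih => exact ih _

theorem embV_subst (t : LT) (k : ℕ) {v : LT} {w : T} (hv : embV v = T.bang w) :
    embV (LT.subst t k v) = T.subst (embV t) k w := by
  induction t generalizing k with
  | var n =>
    simp only [LT.subst, embV, T.subst]
    split_ifs
    · rfl
    · rw [embV_liftN, hv, T.liftN_bang]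
    · rfl
  | lam t ih => simp [LT.subst, embV, T.subst, ih]
  | app t u iht ihu => simp [LT.subst, embV_app, T.subst, iht, ihu, subst_derStrip_embV]
  | sub t u iht ihu => simp [LT.subst, embV, T.subst, iht, ihu]

theorem dNF_embV (t : LT) : dNF (embV t) = embV t := by
  induction t with
  | var n => rfl
  | lam t ih => simp [embV, dNF, ih]
  | app t u iht ihu =>
    rw [embV_app, dNF, dNF, dNF_derStrip, iht, ihu]
    rfl
  | sub t u iht ihu => simp [embV, dNF, iht, ihu]

/-! ### Reflecting redexes along the CBV embedding -/

theorem exists_value_of_embV_eq {t : LT} {w : T} {L : List T}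
    (h : embV t = fillL (T.bang w) L) :
    ∃ (v : LT) (M : List LT),
      v.IsValue ∧ t = fillLN v M ∧ L = M.map embV ∧ embV v = T.bang w := by
  induction t generalizing L with
  | var n =>
    rcases L.eq_nil_or_concat' with rfl | ⟨L, b, rfl⟩
    · exact ⟨LT.var n, [], trivial, rfl, rfl, h⟩
    · simp [fillL_append, fillL, embV] at h
  | lam t =>
    rcases L.eq_nil_or_concat' with rfl | ⟨L, b, rfl⟩
    · exact ⟨LT.lam t, [], trivial, rfl, rfl, h⟩
    · simp [fillL_append, fillL, embV] at h
  | app t u =>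
    rcases L.eq_nil_or_concat' with rfl | ⟨L, b, rfl⟩
    · simp [fillL, embV_app] at h
    · simp [fillL_append, fillL, embV_app] at h
  | sub t u iht ihu =>
    rcases L.eq_nil_or_concat' with rfl | ⟨L, b, rfl⟩
    · simp [fillL, embV] at h
    · simp only [fillL_append, fillL, embV, T.sub.injEq] at h
      obtain ⟨ht, rfl⟩ := h
      obtain ⟨v, M, hv, rfl, rfl, hw⟩ := iht ht
      exact ⟨v, M ++ [u], hv, by rw [fillLN_append]; rfl, by simp, hw⟩

theorem exists_lam_of_derStrip_embV_eq {t : LT} {a : T} {L : List T}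
    (h : derStrip (embV t) = fillL (T.lam a) L) :
    ∃ (b : LT) (M : List LT),
      t = fillLN (LT.lam b) M ∧ L = M.map embV ∧ a = T.bang (embV b) := by
  induction t generalizing L with
  | var n =>
    rcases L.eq_nil_or_concat' with rfl | ⟨L, b, rfl⟩ <;>
      simp [fillL_append, fillL, embV, derStrip, strip?] at h
  | lam t =>
    rcases L.eq_nil_or_concat' with rfl | ⟨L, b, rfl⟩
    · exact ⟨t, [], rfl, rfl, by simpa [fillL, embV, derStrip, strip?] using h.symm⟩
    · simp [fillL_append, fillL, embV, derStrip, strip?] at h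
  | app t u =>
    rcases L.eq_nil_or_concat' with rfl | ⟨L, b, rfl⟩ <;>
      simp [fillL_append, fillL, embV_app, derStrip, strip?] at h
  | sub t u iht ihu =>
    cases hs : strip? (embV t) with
    | none =>
      rcases L.eq_nil_or_concat' with rfl | ⟨L, b, rfl⟩ <;>
        simp [fillL_append, fillL, embV, derStrip, strip?, hs] at h
    | some s =>
      rcases L.eq_nil_or_concat' with rfl | ⟨L, b, rfl⟩
      · simp [fillL, embV, derStrip, strip?, hs] at h
      · simp only [embV, derStrip, strip?, hs, Option.map_some, Option.getD_some,
          fillL_append, fillL, T.sub.injEq] at h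
        obtain ⟨ht, rfl⟩ := h
        obtain ⟨c, M, rfl, rfl, rfl⟩ := iht (L := L) (by simpa [derStrip, hs] using ht)
        exact ⟨c, M ++ [u], by rw [fillLN_append]; rfl, by simp, rfl⟩

theorem exists_step_of_embV_step {t : LT} {s : T} {R' : Rule} (h : FStepR R' (embV t) s) :
    ∃ (u : LT) (R : VRule), embV u = dNF s ∧ embVRule R = R' ∧ VFStepR R t u := by
  induction t generalizing s with
  | var n =>
    obtain ⟨a, ha, rfl⟩ := h.bang_inv
    exact ha.var_inv.elim
  | lam t ih =>
    obtain ⟨a, ha, rfl⟩ := h.bang_inv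
    obtain ⟨b, hb, rfl⟩ := ha.lam_inv
    obtain ⟨c, hc, rfl⟩ := hb.bang_inv
    obtain ⟨u, R, hu, hR, hst⟩ := ih hc
    exact ⟨LT.lam u, R, by simp [embV, dNF, hu], hR, hst.lam⟩
  | sub t₁ t₂ ih₁ ih₂ =>
    rcases h.sub_inv with hr | ⟨a, ha, rfl⟩ | ⟨a, ha, rfl⟩
    · generalize hx : embV t₂ = x at hr
      cases hr with
      | sBang _ w L =>
        obtain ⟨v, M, hv, rfl, rfl, hw⟩ := exists_value_of_embV_eq hx
        refine ⟨_, VRule.sV, ?_, rfl, VFStepR.root (VRoot.sV t₁ v M hv)⟩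
        rw [← dNF_embV, embV_fillLN, embV_subst _ _ hw, embV_liftUnder, List.length_map]
    · obtain ⟨u, R, hu, hR, hst⟩ := ih₁ ha
      exact ⟨LT.sub u t₂, R, by simp [embV, dNF, hu, dNF_embV], hR, hst.subL⟩
    · obtain ⟨u, R, hu, hR, hst⟩ := ih₂ ha
      exact ⟨LT.sub t₁ u, R, by simp [embV, dNF, hu, dNF_embV], hR, hst.subR⟩
  | app t₁ t₂ ih₁ ih₂ =>
    rw [embV_app] at h
    rcases h.der_inv with hr | ⟨a, ha, rfl⟩
    · generalize hx : T.app (derStrip (embV t₁)) (embV t₂) = x at hr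
      cases hr with
      | dBang b L =>
        rcases L.eq_nil_or_concat' with rfl | ⟨L, c, rfl⟩ <;>
          simp [fillL_append, fillL] at hx
    · rcases ha.app_inv with hr | ⟨b, hb, rfl⟩ | ⟨b, hb, rfl⟩
      · generalize hx : derStrip (embV t₁) = x at hr
        cases hr with
        | dB a _ L =>
          obtain ⟨b, M, rfl, rfl, rfl⟩ := exists_lam_of_derStrip_embV_eq hx
          refine ⟨_, VRule.dB, ?_, rfl, VFStepR.root (VRoot.dB b t₂ M)⟩
          have hb : strip? (fillL (T.sub (T.bang (embV b))
              (T.liftN (M.map embV).length (embV t₂))) (M.map embV)) =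
              some (embV (fillLN (LT.sub b (LT.liftN M.length t₂)) M)) := by
            rw [embV_fillLN, embV, embV_liftN, List.length_map]
            exact strip?_fillL rfl _
          rw [dNF, derStrip, strip?_dNF hb, dNF_embV]
          rfl
      · obtain ⟨a, ha, hab⟩ := exists_step_of_derStrip hb
        obtain ⟨u, R, hu, hR, hst⟩ := ih₁ ha
        exact ⟨LT.app u t₂, R,
          by simp [embV_app, dNF, hu, hab, dNF_embV, derStrip, strip?], hR, hst.appL⟩
      · obtain ⟨u, R, hu, hR, hst⟩ := ih₂ hb
        refine ⟨LT.app t₁ u, R, ?_, hR, hst.appR⟩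
        rw [embV_app, dNF, dNF, dNF_derStrip, dNF_embV, hu]
        rfl

/-- **CBV one-step reverse simulation.**  Let `u'` be a `→F,d!`-normal form and
`R' ∈ {dB, s!, d!}`.  If `tᵛ` reaches `u'` by one `→F`-step of rule `R'` followed by
zero or more `→F,d!`-steps, then there exist a CBV term `u` with `uᵛ = u'` and a CBV
rule `R ∈ {dB, sV}` with `Rᵛ = R'` such that `t →ᵛF u` by firing `R` under some CBV
full context. -/
theorem cbv_one_step_reverse_simulation (t : LT) (u' : T) (R' : Rule)
    (hnf : IsNF (FStepR Rule.dBang) u')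
    (h : ∃ s, FStepR R' (embV t) s ∧ Relation.ReflTransGen (FStepR Rule.dBang) s u') :
    ∃ (u : LT) (R : VRule), embV u = u' ∧ embVRule R = R' ∧ VFStepR R t u := by
  obtain ⟨s, hs, hsu⟩ := h
  rw [← dNF_eq_self hnf, ← dNF_eq_of_steps hsu]
  exact exists_step_of_embV_step hs

end BangPaper
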